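/- Let R, I₁, I₂, I₃, J₁, J₂, J₃ be positive integers and let G₁ : [I₁]×[J₁]×[R] → ℝ, G₂ : [R]×[I₂]×[J₂]×[R] → ℝ, G₃ : [R]×[I₃]×[J₃] → ℝ, and define W((k₁,k₂,k₃),(j₁,j₂,j₃)) = Σ_{r,s∈[R]} G₁(k₁,j₁,r)·G₂(r,k₂,j₂,s)·G₃(s,k₃,j₃). Assume: (i) the family of vectors { k₃ ↦ G₃(s,k₃,j) : s ∈ [R], j ∈ [J₃] } is orthonormal in ℝ^{I₃}, i.e., Σ_{k₃} G₃(s,k₃,i)·G₃(s',k₃,j) = 1 if (s,i)=(s',j) and 0 otherwise; (ii) the family { (k₂,s) ↦ G₂(r,k₂,i,s) : r ∈ [R], i ∈ [J₂] } is orthonormal in ℝ^{I₂·R}; (iii) the family { (k₁,r) ↦ G₁(k₁,j,r) : j ∈ [J₁] } is orthonormal in ℝ^{I₁·R}. Then WᵀW is the identity matrix on [J₁]×[J₂]×[J₃]; i.e., the columns of W are orthonormal. -/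

import Mathlib

open Finset

/-- Contracting two families whose cross Gram matrix is `c` times the identity leaves `c` times
the dot product of the coefficients. -/
theorem sum_mul_sum_of_gram_eq_ite {S K A : Type*} [Fintype S] [Fintype K] [DecidableEq S]
    [CommSemiring A] (a b : S → A) (g h : S → K → A) (c : A)
    (hgram : ∀ s s', ∑ k, g s k * h s' k = if s = s' then c else 0) :
    ∑ k, (∑ s, a s * g s k) * (∑ s, b s * h s k) = c * ∑ s, a s * b s := by
  calc
    _ = ∑ s, ∑ s', a s * b s' * ∑ k, g s k * h s' k := by
      simp_rw [Finset.sum_mul_sum, Finset.mul_sum]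
      rw [Finset.sum_comm]
      refine Finset.sum_congr rfl fun s _ => ?_
      rw [Finset.sum_comm]
      refine Finset.sum_congr rfl fun s' _ => Finset.sum_congr rfl fun k _ => ?_
      ring
    _ = _ := by
      simp [hgram, Finset.mul_sum, mul_comm]

/-- If the three tensor-train cores are suitably orthonormal, then the reconstructed matrix `W`
has orthonormal columns, i.e. `WᵀW = I`. -/
theorem tt_cores_orthonormal_implies_semi_orthogonal
    (R I₁ I₂ I₃ J₁ J₂ J₃ : ℕ) (hR : 0 < R) (hI₁ : 0 < I₁) (hI₂ : 0 < I₂) (hI₃ : 0 < I₃)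
    (hJ₁ : 0 < J₁) (hJ₂ : 0 < J₂) (hJ₃ : 0 < J₃)
    (G₁ : Fin I₁ → Fin J₁ → Fin R → ℝ)
    (G₂ : Fin R → Fin I₂ → Fin J₂ → Fin R → ℝ)
    (G₃ : Fin R → Fin I₃ → Fin J₃ → ℝ)
    (W : (Fin I₁ × Fin I₂ × Fin I₃) → (Fin J₁ × Fin J₂ × Fin J₃) → ℝ)
    (hW : ∀ k₁ k₂ k₃ j₁ j₂ j₃, W (k₁, k₂, k₃) (j₁, j₂, j₃)
      = ∑ r : Fin R, ∑ s : Fin R, G₁ k₁ j₁ r * G₂ r k₂ j₂ s * G₃ s k₃ j₃)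
    (hG₃ : ∀ (s s' : Fin R) (i j : Fin J₃),
      (∑ k₃ : Fin I₃, G₃ s k₃ i * G₃ s' k₃ j) = if (s, i) = (s', j) then 1 else 0)
    (hG₂ : ∀ (r r' : Fin R) (i j : Fin J₂),
      (∑ k₂ : Fin I₂, ∑ s : Fin R, G₂ r k₂ i s * G₂ r' k₂ j s)
        = if (r, i) = (r', j) then 1 else 0)
    (hG₁ : ∀ i j : Fin J₁,
      (∑ k₁ : Fin I₁, ∑ r : Fin R, G₁ k₁ i r * G₁ k₁ j r) = if i = j then 1 else 0) :
    ∀ i j : Fin J₁ × Fin J₂ × Fin J₃,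
      (∑ k : Fin I₁ × Fin I₂ × Fin I₃, W k i * W k j) = if i = j then 1 else 0 := by
  rintro ⟨i₁, i₂, i₃⟩ ⟨j₁, j₂, j₃⟩
  have hW' : ∀ k₁ k₂ k₃ j₁ j₂ j₃, W (k₁, k₂, k₃) (j₁, j₂, j₃)
      = ∑ s, (∑ r, G₁ k₁ j₁ r * G₂ r k₂ j₂ s) * G₃ s k₃ j₃ := by
    intro k₁ k₂ k₃ j₁ j₂ j₃
    rw [hW, Finset.sum_comm]
    simp_rw [Finset.sum_mul]
  have contract₃ : ∀ k₁ k₂, ∑ k₃, W (k₁, k₂, k₃) (i₁, i₂, i₃) * W (k₁, k₂, k₃) (j₁, j₂, j₃)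
      = (if i₃ = j₃ then 1 else 0) * ∑ s, (∑ r, G₁ k₁ i₁ r * G₂ r k₂ i₂ s) *
        ∑ r, G₁ k₁ j₁ r * G₂ r k₂ j₂ s := by
    intro k₁ k₂
    simp_rw [hW']
    refine sum_mul_sum_of_gram_eq_ite _ _ (fun s k => G₃ s k i₃) (fun s k => G₃ s k j₃) _ ?_
    intro s s'
    simp [hG₃, ite_and]
  have contract₂ : ∀ k₁, ∑ k₂, ∑ s, (∑ r, G₁ k₁ i₁ r * G₂ r k₂ i₂ s) *
        (∑ r, G₁ k₁ j₁ r * G₂ r k₂ j₂ s)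
      = (if i₂ = j₂ then 1 else 0) * ∑ r, G₁ k₁ i₁ r * G₁ k₁ j₁ r := by
    intro k₁
    rw [← Fintype.sum_prod_type']
    refine sum_mul_sum_of_gram_eq_ite _ _ (fun r (p : Fin I₂ × Fin R) => G₂ r p.1 i₂ p.2)
      (fun r p => G₂ r p.1 j₂ p.2) _ ?_
    intro r r'
    simp [Fintype.sum_prod_type, hG₂, ite_and]
  simp_rw [Fintype.sum_prod_type, contract₃, ← Finset.mul_sum, contract₂, ← Finset.mul_sum, hG₁]
  by_cases h₁ : i₁ = j₁ <;> by_cases h₂ : i₂ = j₂ <;> by_cases h₃ : i₃ = j₃ <;>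
    simp [h₁, h₂, h₃]
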